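/- Let A ∈ ℝ^{m×n} with m ≥ n have full column rank, let W ∈ ℝ^{m×m} be symmetric positive definite, and let b ∈ ℝ^m. Define A† := (AᵀWA)⁻¹AᵀW, x := A†b, d := W(b − Ax), let L ∈ ℝ^{n×k}, and set V := (AᵀWA)⁻¹ ⊗ dᵀ − xᵀ ⊗ A† ∈ ℝ^{n×mn}. Assume all components of Lᵀx are nonzero and let D := diag(Lᵀx). Then the componentwise condition number K_c := ‖ |D⁻¹|(|LᵀV| vec(|A|) + |LᵀA†| |b|) ‖_∞ satisfies K_c ≤ ‖D⁻¹Lᵀ(AᵀWA)⁻¹ D_{|A|ᵀ|d|}‖_∞ + ‖D⁻¹LᵀA† D_{|A||x|}‖_∞ + ‖D⁻¹LᵀA† D_{|b|}‖_∞, where each term on the right is a maximum absolute row-sum matrix norm. -/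

import Mathlib

open Matrix

/-- The maximum absolute row-sum norm of a real matrix. -/
noncomputable def rowSumNorm {p q : Type*} [Fintype q] (M : Matrix p q ℝ) : ℝ :=
  ⨆ i, ∑ j, |M i j|

/-- The vector ∞-norm. -/
noncomputable def infNormV {p : Type*} (v : p → ℝ) : ℝ :=
  ⨆ i, |v i|

theorem sum_abs_le_rowSumNorm {p q : Type*} [Finite p] [Fintype q] (M : Matrix p q ℝ) (i : p) :
    ∑ j, |M i j| ≤ rowSumNorm M :=
  le_ciSup (f := fun i => ∑ j, |M i j|) (Set.finite_range _).bddAbove i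

theorem rowSumNorm_nonneg {p q : Type*} [Fintype q] (M : Matrix p q ℝ) : 0 ≤ rowSumNorm M :=
  Real.iSup_nonneg fun _ => Finset.sum_nonneg fun _ _ => abs_nonneg _

theorem infNormV_le {p : Type*} {v : p → ℝ} {c : ℝ} (hc : 0 ≤ c) (h : ∀ i, |v i| ≤ c) :
    infNormV v ≤ c :=
  Real.iSup_le h hc

/-- Row sums of a row- and column-scaled matrix. -/
theorem sum_abs_diagonal_mul_mul_diagonal {p q r : Type*} [Fintype p] [DecidableEq p]
    [Fintype q] [DecidableEq q] [Fintype r] (e : p → ℝ) (M : Matrix p r ℝ) (N : Matrix r q ℝ)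
    {v : q → ℝ} (hv : ∀ j, 0 ≤ v j) (i : p) :
    ∑ j, |(diagonal e * M * N * diagonal v) i j| = |e i| * ∑ j, |(M * N) i j| * v j := by
  rw [Finset.mul_sum]
  refine Finset.sum_congr rfl fun j _ => ?_
  rw [mul_diagonal, Matrix.mul_assoc, diagonal_mul, abs_mul, abs_mul, abs_of_nonneg (hv j),
    mul_assoc]

/-- Triangle inequality for a weighted sum of the entries of a difference of two rank-one-type
arrays. -/
theorem sum_abs_sub_mul_abs_le {p q : Type*} [Fintype p] [Fintype q] (A : Matrix p q ℝ)
    (f x : q → ℝ) (g d : p → ℝ) :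
    ∑ ji : q × p, |f ji.1 * d ji.2 - x ji.1 * g ji.2| * |A ji.2 ji.1| ≤
      ∑ j, |f j| * ((Aᵀ.map abs) *ᵥ fun i => |d i|) j +
        ∑ l, |g l| * ((A.map abs) *ᵥ fun j => |x j|) l := by
  simp only [mulVec, dotProduct, map_apply, transpose_apply, Finset.mul_sum]
  rw [Finset.sum_comm (f := fun l j => |g l| * (|A l j| * |x j|)), Fintype.sum_prod_type,
    ← Finset.sum_add_distrib]
  refine Finset.sum_le_sum fun j _ => ?_
  rw [← Finset.sum_add_distrib]
  refine Finset.sum_le_sum fun l _ => ?_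
  calc |f j * d l - x j * g l| * |A l j|
      ≤ (|f j * d l| + |x j * g l|) * |A l j| :=
        mul_le_mul_of_nonneg_right (abs_sub _ _) (abs_nonneg _)
    _ = |f j| * (|A l j| * |d l|) + |g l| * (|A l j| * |x j|) := by
        rw [abs_mul, abs_mul]; ring

/-- the upper bound for the componentwise condition number:
`K_c ≤ ‖D⁻¹Lᵀ(AᵀWA)⁻¹ D_{|A|ᵀ|d|}‖_∞ + ‖D⁻¹LᵀA† D_{|A||x|}‖_∞ +
‖D⁻¹LᵀA† D_{|b|}‖_∞`. -/
theorem wls_componentwise_condition_number_upper_bound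
    {m n k : ℕ} (hmn : n ≤ m)
    (A : Matrix (Fin m) (Fin n) ℝ) (hA : A.rank = n)
    (W : Matrix (Fin m) (Fin m) ℝ) (hWsym : W.IsSymm) (hW : W.PosDef)
    (b : Fin m → ℝ) (L : Matrix (Fin n) (Fin k) ℝ)
    (hLx : ∀ i, (Lᵀ *ᵥ (((Aᵀ * W * A)⁻¹ * Aᵀ * W) *ᵥ b)) i ≠ 0) :
    let C := (Aᵀ * W * A)⁻¹
    let Adag := C * Aᵀ * W
    let x := Adag *ᵥ b
    let d := W *ᵥ (b - A *ᵥ x)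
    let V : Matrix (Fin n) (Fin n × Fin m) ℝ :=
      Matrix.of fun r ji => C r ji.1 * d ji.2 - x ji.1 * Adag r ji.2
    let D : Matrix (Fin k) (Fin k) ℝ := Matrix.diagonal (Lᵀ *ᵥ x)
    infNormV ((D⁻¹.map abs) *ᵥ
        (((Lᵀ * V).map abs) *ᵥ (fun ji : Fin n × Fin m => |A ji.2 ji.1|) +
          ((Lᵀ * Adag).map abs) *ᵥ (fun i => |b i|))) ≤
      rowSumNorm (D⁻¹ * Lᵀ * C * Matrix.diagonal ((Aᵀ.map abs) *ᵥ (fun i => |d i|))) +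
      rowSumNorm (D⁻¹ * Lᵀ * Adag * Matrix.diagonal ((A.map abs) *ᵥ (fun j => |x j|))) +
      rowSumNorm (D⁻¹ * Lᵀ * Adag * Matrix.diagonal (fun i => |b i|)) := by
  intro C Adag x d V D
  have abs_mulVec_nonneg {p q : Type} [Fintype q] (M : Matrix p q ℝ) (v : q → ℝ) (i : p) :
      0 ≤ ((M.map abs) *ᵥ fun j => |v j|) i :=
    Finset.sum_nonneg fun _ _ => mul_nonneg (abs_nonneg _) (abs_nonneg _)
  obtain ⟨e, he⟩ : ∃ e, D⁻¹ = diagonal e := ⟨_, inv_diagonal _⟩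
  have hV (i : Fin k) (ji : Fin n × Fin m) :
      (Lᵀ * V) i ji = (Lᵀ * C) i ji.1 * d ji.2 - x ji.1 * (Lᵀ * Adag) i ji.2 := by
    simp only [V, mul_apply, of_apply, Finset.sum_mul, Finset.mul_sum, ← Finset.sum_sub_distrib]
    exact Finset.sum_congr rfl fun r _ => by ring
  rw [he]
  refine infNormV_le (add_nonneg (add_nonneg (rowSumNorm_nonneg _) (rowSumNorm_nonneg _))
    (rowSumNorm_nonneg _)) fun i => ?_
  refine le_trans ?_ (add_le_add (add_le_add (sum_abs_le_rowSumNorm _ i)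
    (sum_abs_le_rowSumNorm _ i)) (sum_abs_le_rowSumNorm _ i))
  rw [sum_abs_diagonal_mul_mul_diagonal e _ _ (abs_mulVec_nonneg _ _),
    sum_abs_diagonal_mul_mul_diagonal e _ _ (abs_mulVec_nonneg _ _),
    sum_abs_diagonal_mul_mul_diagonal e _ _ (fun _ => abs_nonneg _), ← mul_add, ← mul_add,
    diagonal_map abs_zero, mulVec_diagonal, abs_mul, abs_abs, Pi.add_apply,
    abs_of_nonneg (add_nonneg (abs_mulVec_nonneg _ (fun ji : Fin n × Fin m => A ji.2 ji.1) i)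
      (abs_mulVec_nonneg _ b i))]
  refine mul_le_mul_of_nonneg_left (add_le_add ?_ le_rfl) (abs_nonneg _)
  simp only [mulVec, dotProduct, map_apply, hV]
  exact sum_abs_sub_mul_abs_le A _ x _ d
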